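/- Let N ≥ 1. Suppose the system x_{k+1} = A(ξ_k) x_k satisfies Assumption 3 (essential boundedness), ξ has the Markov property, and ξ is N-periodically stationary, i.e., the shifted process (ξ_{k+N})_{k∈ℤ} has the same law as (ξ_k)_{k∈ℤ}. Then the system is exponentially stable in the second moment if and only if there exist ε̲₂, ε̄₂, ε₂ > 0, λ₂ ∈ (0,1), and Borel-measurable functions R_k : ℝ^Z → Sym_n(ℝ) for k = 0, …, N−1, with R_N := R₀, such that for each k = 0, …, N−1: ε̲₂ I ≼ R_k(ξ_{k−1}) ≼ ε̄₂ I a.s. and λ₂² R_k(ξ_{k−1}) − A(ξ_{k−1})ᵀ E[R_{k+1}(ξ_k) | σ(ξ_{k−1})] A(ξ_{k−1}) ≽ ε₂ I a.s., where σ(ξ_{k−1}) is the σ-algebra generated by ξ_{k−1}. -/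

import Mathlib

open MeasureTheory Matrix ProbabilityTheory

noncomputable section

namespace SMS

variable {Ω : Type} [MeasurableSpace Ω]

/-- The σ-algebra generated by the random vectors `ξ t` for `t ≤ k`. -/
def pastSigma {Z : ℕ} (ξ : ℤ → Ω → (Fin Z → ℝ)) (k : ℤ) : MeasurableSpace Ω :=
  ⨆ t : {t : ℤ // t ≤ k}, MeasurableSpace.comap (ξ t.1) inferInstance

/-- The σ-algebra generated by a single random vector. -/
def sigmaOf {Z : ℕ} (η : Ω → (Fin Z → ℝ)) : MeasurableSpace Ω :=
  MeasurableSpace.comap η inferInstance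

/-- The state `x_{k₀+m}` of the system `x_{k+1} = A(ξ_k) x_k` with `x_{k₀} = x0`. -/
def state {n Z : ℕ} (A : (Fin Z → ℝ) → Matrix (Fin n) (Fin n) ℝ)
    (ξ : ℤ → Ω → (Fin Z → ℝ)) (k₀ : ℤ) (x0 : Fin n → ℝ) : ℕ → Ω → (Fin n → ℝ)
  | 0 => fun _ => x0
  | (m + 1) => fun ω => (A (ξ (k₀ + m) ω)).mulVec (state A ξ k₀ x0 m ω)

/-- Squared Euclidean norm. -/
def sqNorm {n : ℕ} (v : Fin n → ℝ) : ℝ := ∑ i, (v i) ^ 2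

/-- Conditional second moment `E[‖x_{k₀+m}‖² | 𝒢_{k₀-1}]` as a function on `Ω`. -/
def smom {n Z : ℕ} (μ : Measure Ω) (A : (Fin Z → ℝ) → Matrix (Fin n) (Fin n) ℝ)
    (ξ : ℤ → Ω → (Fin Z → ℝ)) (k₀ : ℤ) (x0 : Fin n → ℝ) (m : ℕ) : Ω → ℝ :=
  μ[(fun ω => sqNorm (state A ξ k₀ x0 m ω)) | pastSigma ξ (k₀ - 1)]

/-- Assumption 1: conditionally bounded second moments of the entries of `A(ξ_{k₀})`. -/
def Assumption1 {n Z : ℕ} (μ : Measure Ω) (A : (Fin Z → ℝ) → Matrix (Fin n) (Fin n) ℝ)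
    (ξ : ℤ → Ω → (Fin Z → ℝ)) : Prop :=
  ∀ k₀ : ℤ, ∃ M₁ : ℝ, 0 < M₁ ∧ ∀ i j : Fin n,
    ∀ᵐ ω ∂μ, (μ[(fun ω' => (A (ξ k₀ ω') i j) ^ 2) | pastSigma ξ (k₀ - 1)]) ω ≤ M₁

/-- Assumption 2: (strict) stationarity of the process `ξ`. -/
def Stationary {Z : ℕ} (μ : Measure Ω) (ξ : ℤ → Ω → (Fin Z → ℝ)) : Prop :=
  ∀ s : ℤ, Measure.map (fun ω => fun k : ℤ => ξ (k + s) ω) μ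
    = Measure.map (fun ω => fun k : ℤ => ξ k ω) μ

/-- N-periodic stationarity of the process `ξ`. -/
def PeriodicStationary {Z : ℕ} (μ : Measure Ω) (ξ : ℤ → Ω → (Fin Z → ℝ)) (N : ℕ) : Prop :=
  Measure.map (fun ω => fun k : ℤ => ξ (k + N) ω) μ = Measure.map (fun ω => fun k : ℤ => ξ k ω) μ

/-- Assumption 3: essential boundedness of the entries of the coefficient matrices. -/
def Assumption3 {n Z : ℕ} (μ : Measure Ω) (A : (Fin Z → ℝ) → Matrix (Fin n) (Fin n) ℝ)
    (ξ : ℤ → Ω → (Fin Z → ℝ)) : Prop :=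
  ∃ M₃ : ℝ, 0 < M₃ ∧ ∀ k : ℤ, ∀ i j : Fin n, ∀ᵐ ω ∂μ, |A (ξ k ω) i j| < M₃

/-- Markov property of `ξ`. -/
def MarkovProp {Z : ℕ} (μ : Measure Ω) (ξ : ℤ → Ω → (Fin Z → ℝ)) : Prop :=
  ∀ i j : ℤ, i < j → ∀ f : (Fin Z → ℝ) → ℝ, Measurable f → (∃ C : ℝ, ∀ v, |f v| ≤ C) →
    (μ[(fun ω => f (ξ j ω)) | pastSigma ξ i]) =ᵐ[μ] (μ[(fun ω => f (ξ j ω)) | sigmaOf (ξ i)])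

/-- Exponential stability in the second moment, with given rate `lam`. -/
def ExpStableWith {n Z : ℕ} (μ : Measure Ω) (A : (Fin Z → ℝ) → Matrix (Fin n) (Fin n) ℝ)
    (ξ : ℤ → Ω → (Fin Z → ℝ)) (lam : ℝ) : Prop :=
  ∃ a : ℝ, 0 < a ∧ ∀ k₀ : ℤ, ∀ x0 : Fin n → ℝ, ∀ m : ℕ,
    ∀ᵐ ω ∂μ, smom μ A ξ k₀ x0 m ω ≤ a * sqNorm x0 * lam ^ (2 * m)

/-- Exponential stability in the second moment. -/
def ExpStable {n Z : ℕ} (μ : Measure Ω) (A : (Fin Z → ℝ) → Matrix (Fin n) (Fin n) ℝ)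
    (ξ : ℤ → Ω → (Fin Z → ℝ)) : Prop :=
  ∃ lam : ℝ, 0 < lam ∧ lam < 1 ∧ ExpStableWith μ A ξ lam

/-- Stability in the second moment. -/
def Stable {n Z : ℕ} (μ : Measure Ω) (A : (Fin Z → ℝ) → Matrix (Fin n) (Fin n) ℝ)
    (ξ : ℤ → Ω → (Fin Z → ℝ)) : Prop :=
  ∀ ε : ℝ, 0 < ε → ∀ k₀ : ℤ, ∃ δ : ℝ, 0 < δ ∧ ∀ x0 : Fin n → ℝ, sqNorm x0 ≤ δ →
    ∀ m : ℕ, ∀ᵐ ω ∂μ, smom μ A ξ k₀ x0 m ω ≤ ε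

/-- Uniform stability in the second moment. -/
def UnifStable {n Z : ℕ} (μ : Measure Ω) (A : (Fin Z → ℝ) → Matrix (Fin n) (Fin n) ℝ)
    (ξ : ℤ → Ω → (Fin Z → ℝ)) : Prop :=
  ∀ ε : ℝ, 0 < ε → ∃ δ : ℝ, 0 < δ ∧ ∀ k₀ : ℤ, ∀ x0 : Fin n → ℝ, sqNorm x0 ≤ δ →
    ∀ m : ℕ, ∀ᵐ ω ∂μ, smom μ A ξ k₀ x0 m ω ≤ ε

/-- Uniform attractivity in the second moment. -/
def Attractive {n Z : ℕ} (μ : Measure Ω) (A : (Fin Z → ℝ) → Matrix (Fin n) (Fin n) ℝ)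
    (ξ : ℤ → Ω → (Fin Z → ℝ)) : Prop :=
  ∀ ε : ℝ, 0 < ε → ∃ K : ℕ, ∀ k₀ : ℤ, ∀ x0 : Fin n → ℝ, ∀ m : ℕ, K ≤ m →
    ∀ᵐ ω ∂μ, smom μ A ξ k₀ x0 m ω ≤ ε * sqNorm x0

/-- Uniform asymptotic stability in the second moment. -/
def UnifAsympStable {n Z : ℕ} (μ : Measure Ω) (A : (Fin Z → ℝ) → Matrix (Fin n) (Fin n) ℝ)
    (ξ : ℤ → Ω → (Fin Z → ℝ)) : Prop :=
  UnifStable μ A ξ ∧ Attractive μ A ξ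

/-- Asymptotic stability in the second moment. -/
def AsympStable {n Z : ℕ} (μ : Measure Ω) (A : (Fin Z → ℝ) → Matrix (Fin n) (Fin n) ℝ)
    (ξ : ℤ → Ω → (Fin Z → ℝ)) : Prop :=
  Stable μ A ξ ∧ ∀ k₀ : ℤ, ∀ x0 : Fin n → ℝ,
    ∀ᵐ ω ∂μ, Filter.Tendsto (fun m => smom μ A ξ k₀ x0 m ω) Filter.atTop (nhds 0)

/-- Quadratic stability. -/
def QuadStable {n Z : ℕ} (μ : Measure Ω) (A : (Fin Z → ℝ) → Matrix (Fin n) (Fin n) ℝ)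
    (ξ : ℤ → Ω → (Fin Z → ℝ)) : Prop :=
  ∃ P₀ : Matrix (Fin n) (Fin n) ℝ, P₀.PosDef ∧ ∃ lam : ℝ, 0 < lam ∧ lam < 1 ∧
    ∀ k₀ : ℤ, ∀ x0 : Fin n → ℝ, ∀ m : ℕ, ∀ᵐ ω ∂μ,
      (μ[(fun ω' => state A ξ k₀ x0 (m + 1) ω' ⬝ᵥ P₀.mulVec (state A ξ k₀ x0 (m + 1) ω'))
          | pastSigma ξ (k₀ - 1)]) ω
      ≤ lam ^ 2 * (μ[(fun ω' => state A ξ k₀ x0 m ω' ⬝ᵥ P₀.mulVec (state A ξ k₀ x0 m ω'))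
          | pastSigma ξ (k₀ - 1)]) ω

/-- Entrywise conditional expectation of a random matrix. -/
def condExpM {n : ℕ} (μ : Measure Ω) (m : MeasurableSpace Ω)
    (M : Ω → Matrix (Fin n) (Fin n) ℝ) : Ω → Matrix (Fin n) (Fin n) ℝ :=
  fun ω => Matrix.of fun i j => (μ[(fun ω' => M ω' i j) | m]) ω

/-- Entrywise expectation of a random matrix. -/
def expM {n : ℕ} (μ : Measure Ω) (M : Ω → Matrix (Fin n) (Fin n) ℝ) :
    Matrix (Fin n) (Fin n) ℝ :=
  Matrix.of fun i j => ∫ ω, M ω i j ∂μ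

/-- The forward path `(ξ_{k+t})_{t ∈ ℕ}` of the process `ξ` from time `k`. -/
def pathFrom {Z : ℕ} (ξ : ℤ → Ω → (Fin Z → ℝ)) (k : ℤ) : Ω → (ℕ → Fin Z → ℝ) :=
  fun ω t => ξ (k + t) ω

/-- Condition (P) with decay rate `lam`: the Lyapunov inequality
`E₀[λ₁² P_{k₀} − A(ξ_{k₀})ᵀ E₀[P_{k₀+1} | 𝒢_{k₀}] A(ξ_{k₀})] ≽ 0` together with the uniform
bounds `ε̲₁ I ≼ E₀[P_{k₀}] ≼ ε̄₁ I`. -/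
def CondP {n Z : ℕ} (μ : Measure Ω) (A : (Fin Z → ℝ) → Matrix (Fin n) (Fin n) ℝ)
    (ξ : ℤ → Ω → (Fin Z → ℝ)) (lam : ℝ) : Prop :=
  ∃ el eu : ℝ, 0 < el ∧ 0 < eu ∧
    ∃ P : (ℕ → Fin Z → ℝ) → Matrix (Fin n) (Fin n) ℝ,
      (∀ i j : Fin n, Measurable fun v => P v i j) ∧ (∀ v, (P v).IsSymm) ∧
      ∀ k₀ : ℤ,
        (∀ᵐ ω ∂μ, (condExpM μ (pastSigma ξ (k₀ - 1)) (fun ω' => P (pathFrom ξ k₀ ω')) ω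
            - el • (1 : Matrix (Fin n) (Fin n) ℝ)).PosSemidef) ∧
        (∀ᵐ ω ∂μ, (eu • (1 : Matrix (Fin n) (Fin n) ℝ)
            - condExpM μ (pastSigma ξ (k₀ - 1)) (fun ω' => P (pathFrom ξ k₀ ω')) ω).PosSemidef) ∧
        (∀ᵐ ω ∂μ, (condExpM μ (pastSigma ξ (k₀ - 1)) (fun ω' =>
            lam ^ 2 • P (pathFrom ξ k₀ ω')
            - (A (ξ k₀ ω'))ᵀ
              * condExpM μ (pastSigma ξ k₀) (fun ω'' => P (pathFrom ξ (k₀ + 1) ω'')) ω'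
              * (A (ξ k₀ ω'))) ω).PosSemidef)

/-- Condition (P) without decay rate: the strict Lyapunov inequality
`E₀[P_{k₀} − A(ξ_{k₀})ᵀ E₀[P_{k₀+1} | 𝒢_{k₀}] A(ξ_{k₀})] ≽ ε₁ I`. -/
def CondPstrict {n Z : ℕ} (μ : Measure Ω) (A : (Fin Z → ℝ) → Matrix (Fin n) (Fin n) ℝ)
    (ξ : ℤ → Ω → (Fin Z → ℝ)) : Prop :=
  ∃ el eu ep : ℝ, 0 < el ∧ 0 < eu ∧ 0 < ep ∧
    ∃ P : (ℕ → Fin Z → ℝ) → Matrix (Fin n) (Fin n) ℝ,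
      (∀ i j : Fin n, Measurable fun v => P v i j) ∧ (∀ v, (P v).IsSymm) ∧
      ∀ k₀ : ℤ,
        (∀ᵐ ω ∂μ, (condExpM μ (pastSigma ξ (k₀ - 1)) (fun ω' => P (pathFrom ξ k₀ ω')) ω
            - el • (1 : Matrix (Fin n) (Fin n) ℝ)).PosSemidef) ∧
        (∀ᵐ ω ∂μ, (eu • (1 : Matrix (Fin n) (Fin n) ℝ)
            - condExpM μ (pastSigma ξ (k₀ - 1)) (fun ω' => P (pathFrom ξ k₀ ω')) ω).PosSemidef) ∧
        (∀ᵐ ω ∂μ, (condExpM μ (pastSigma ξ (k₀ - 1)) (fun ω' =>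
            P (pathFrom ξ k₀ ω')
            - (A (ξ k₀ ω'))ᵀ
              * condExpM μ (pastSigma ξ k₀) (fun ω'' => P (pathFrom ξ (k₀ + 1) ω'')) ω'
              * (A (ξ k₀ ω'))) ω - ep • (1 : Matrix (Fin n) (Fin n) ℝ)).PosSemidef)

/-- Condition (R) with decay rate `lam` (for essentially bounded coefficients). -/
def CondR {n Z : ℕ} (μ : Measure Ω) (A : (Fin Z → ℝ) → Matrix (Fin n) (Fin n) ℝ)
    (ξ : ℤ → Ω → (Fin Z → ℝ)) (lam : ℝ) : Prop :=
  ∃ el eu ep : ℝ, 0 < el ∧ 0 < eu ∧ 0 < ep ∧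
    ∃ R : (ℕ → Fin Z → ℝ) → Matrix (Fin n) (Fin n) ℝ,
      (∀ i j : Fin n, Measurable fun v => R v i j) ∧ (∀ v, (R v).IsSymm) ∧
      ∀ k₀ : ℤ,
        (∀ᵐ ω ∂μ, (condExpM μ (pastSigma ξ k₀) (fun ω' => R (pathFrom ξ k₀ ω')) ω
            - el • (1 : Matrix (Fin n) (Fin n) ℝ)).PosSemidef) ∧
        (∀ᵐ ω ∂μ, (eu • (1 : Matrix (Fin n) (Fin n) ℝ)
            - condExpM μ (pastSigma ξ k₀) (fun ω' => R (pathFrom ξ k₀ ω')) ω).PosSemidef) ∧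
        (∀ᵐ ω ∂μ, (lam ^ 2 • condExpM μ (pastSigma ξ k₀) (fun ω' => R (pathFrom ξ k₀ ω')) ω
            - (A (ξ k₀ ω))ᵀ
              * condExpM μ (pastSigma ξ k₀) (fun ω' => R (pathFrom ξ (k₀ + 1) ω')) ω
              * (A (ξ k₀ ω))
            - ep • (1 : Matrix (Fin n) (Fin n) ℝ)).PosSemidef)

/-- Condition (R) without decay rate. -/
def CondRstrict {n Z : ℕ} (μ : Measure Ω) (A : (Fin Z → ℝ) → Matrix (Fin n) (Fin n) ℝ)
    (ξ : ℤ → Ω → (Fin Z → ℝ)) : Prop :=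
  ∃ el eu ep : ℝ, 0 < el ∧ 0 < eu ∧ 0 < ep ∧
    ∃ R : (ℕ → Fin Z → ℝ) → Matrix (Fin n) (Fin n) ℝ,
      (∀ i j : Fin n, Measurable fun v => R v i j) ∧ (∀ v, (R v).IsSymm) ∧
      ∀ k₀ : ℤ,
        (∀ᵐ ω ∂μ, (condExpM μ (pastSigma ξ k₀) (fun ω' => R (pathFrom ξ k₀ ω')) ω
            - el • (1 : Matrix (Fin n) (Fin n) ℝ)).PosSemidef) ∧
        (∀ᵐ ω ∂μ, (eu • (1 : Matrix (Fin n) (Fin n) ℝ)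
            - condExpM μ (pastSigma ξ k₀) (fun ω' => R (pathFrom ξ k₀ ω')) ω).PosSemidef) ∧
        (∀ᵐ ω ∂μ, (condExpM μ (pastSigma ξ k₀) (fun ω' => R (pathFrom ξ k₀ ω')) ω
            - (A (ξ k₀ ω))ᵀ
              * condExpM μ (pastSigma ξ k₀) (fun ω' => R (pathFrom ξ (k₀ + 1) ω')) ω
              * (A (ξ k₀ ω))
            - ep • (1 : Matrix (Fin n) (Fin n) ℝ)).PosSemidef)

/-! ### Quadratic forms -/

/-- Quadratic form of a matrix. -/
def qf {n : ℕ} (M : Matrix (Fin n) (Fin n) ℝ) (x : Fin n → ℝ) : ℝ :=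
  ∑ i, ∑ j, x i * x j * M i j

lemma qf_eq {n : ℕ} (M : Matrix (Fin n) (Fin n) ℝ) (x : Fin n → ℝ) :
    qf M x = x ⬝ᵥ M *ᵥ x := by
  simp only [qf, dotProduct, mulVec, Finset.mul_sum]
  refine Finset.sum_congr rfl fun i _ => Finset.sum_congr rfl fun j _ => by ring

lemma qf_sub {n : ℕ} (M M' : Matrix (Fin n) (Fin n) ℝ) (x : Fin n → ℝ) :
    qf (M - M') x = qf M x - qf M' x := by
  simp only [qf_eq, sub_mulVec, dotProduct_sub]

lemma qf_add {n : ℕ} (M M' : Matrix (Fin n) (Fin n) ℝ) (x : Fin n → ℝ) :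
    qf (M + M') x = qf M x + qf M' x := by
  simp only [qf_eq, add_mulVec, dotProduct_add]

lemma qf_smul {n : ℕ} (c : ℝ) (M : Matrix (Fin n) (Fin n) ℝ) (x : Fin n → ℝ) :
    qf (c • M) x = c * qf M x := by
  simp only [qf_eq, smul_mulVec, dotProduct_smul, smul_eq_mul]

lemma qf_one {n : ℕ} (x : Fin n → ℝ) : qf (1 : Matrix (Fin n) (Fin n) ℝ) x = sqNorm x := by
  simp only [qf_eq, one_mulVec, sqNorm, dotProduct, sq]

lemma qf_conj {n : ℕ} (B M : Matrix (Fin n) (Fin n) ℝ) (x : Fin n → ℝ) :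
    qf (Bᵀ * M * B) x = qf M (B *ᵥ x) := by
  simp only [qf_eq]
  rw [← mulVec_mulVec, ← mulVec_mulVec, dotProduct_mulVec, vecMul_transpose]

lemma psd_iff {n : ℕ} {M : Matrix (Fin n) (Fin n) ℝ} (hM : M.IsSymm) :
    M.PosSemidef ↔ ∀ x, 0 ≤ qf M x := by
  rw [posSemidef_iff_dotProduct_mulVec]
  simp only [star_trivial, qf_eq]
  refine ⟨fun h => h.2, fun h => ⟨?_, h⟩⟩
  rw [Matrix.IsHermitian, conjTranspose_eq_transpose_of_trivial]; exact hM

lemma psd_qf {n : ℕ} {M : Matrix (Fin n) (Fin n) ℝ} (hM : M.PosSemidef) (x : Fin n → ℝ) :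
    0 ≤ qf M x := by
  rw [qf_eq]; simpa using (posSemidef_iff_dotProduct_mulVec.1 hM).2 x

lemma sqNorm_nonneg {n : ℕ} (x : Fin n → ℝ) : 0 ≤ sqNorm x :=
  Finset.sum_nonneg fun _ _ => sq_nonneg _

lemma sum_sq_bound {n : ℕ} (x : Fin n → ℝ) (c : ℝ) :
    ∑ i : Fin n, ∑ j : Fin n, c * ((x i) ^ 2 + (x j) ^ 2) = 2 * c * n * sqNorm x := by
  simp only [sqNorm, mul_add, Finset.sum_add_distrib, Finset.sum_const, Finset.card_univ,
    Fintype.card_fin, nsmul_eq_mul, ← Finset.mul_sum]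
  ring

/-- A quadratic form with entries bounded by `C` is bounded by `n C |x|²`. -/
lemma qf_le_of_entries {n : ℕ} {M : Matrix (Fin n) (Fin n) ℝ} {C : ℝ}
    (h : ∀ i j, |M i j| ≤ C) (x : Fin n → ℝ) : qf M x ≤ n * C * sqNorm x := by
  have h1 : 2 * qf M x ≤ ∑ i : Fin n, ∑ j : Fin n, C * ((x i) ^ 2 + (x j) ^ 2) := by
    rw [qf, Finset.mul_sum]
    refine Finset.sum_le_sum fun i _ => ?_
    rw [Finset.mul_sum]
    refine Finset.sum_le_sum fun j _ => ?_
    have := abs_le.1 (h i j)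
    nlinarith [mul_nonneg (by linarith [this.2] : 0 ≤ C - M i j) (sq_nonneg (x i + x j)),
      mul_nonneg (by linarith [this.1] : 0 ≤ C + M i j) (sq_nonneg (x i - x j))]
  rw [sum_sq_bound] at h1
  linarith

/-- Entries of a matrix are recovered from its quadratic form. -/
lemma qf_pair {n : ℕ} {M : Matrix (Fin n) (Fin n) ℝ} (hM : M.IsSymm) (i j : Fin n) (a b : ℝ) :
    qf M (Pi.single i a + Pi.single j b) = a ^ 2 * M i i + 2 * a * b * M i j + b ^ 2 * M j j := by
  have hij : M j i = M i j := hM.apply i j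
  simp only [qf_eq, mulVec_add, dotProduct_add, add_dotProduct, mulVec_single,
    single_dotProduct, col_apply, Pi.smul_apply, MulOpposite.smul_eq_mul_unop, MulOpposite.unop_op]
  simp only [hij]
  ring

lemma qf_le_of_diag {n : ℕ} {M : Matrix (Fin n) (Fin n) ℝ} (hM : M.IsSymm) {C : ℝ}
    (hp : ∀ x, 0 ≤ qf M x)
    (h : ∀ i, M i i ≤ C) (x : Fin n → ℝ) : qf M x ≤ n * C * sqNorm x := by
  have h1 : 2 * qf M x ≤ ∑ i : Fin n, ∑ j : Fin n, C * ((x i) ^ 2 + (x j) ^ 2) := by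
    rw [qf, Finset.mul_sum]
    refine Finset.sum_le_sum fun i _ => ?_
    rw [Finset.mul_sum]
    refine Finset.sum_le_sum fun j _ => ?_
    have := hp (Pi.single i (x i) + Pi.single j (-(x j)))
    rw [qf_pair hM] at this
    nlinarith [mul_le_mul_of_nonneg_left (h i) (sq_nonneg (x i)),
      mul_le_mul_of_nonneg_left (h j) (sq_nonneg (x j))]
  rw [sum_sq_bound] at h1
  linarith

lemma qf_single {n : ℕ} {M : Matrix (Fin n) (Fin n) ℝ} (i : Fin n) :
    qf M (Pi.single i 1) = M i i := by
  simp [qf_eq]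

lemma sqNorm_single {n : ℕ} (i : Fin n) : sqNorm (Pi.single i (1 : ℝ)) = 1 := by
  rw [← qf_one, qf_single, one_apply_eq]

lemma entry_le {n : ℕ} {M : Matrix (Fin n) (Fin n) ℝ} (hM : M.IsSymm) {C : ℝ}
    (hp : ∀ x, 0 ≤ qf M x) (h : ∀ x, qf M x ≤ C * sqNorm x) (i j : Fin n) : |M i j| ≤ C := by
  have hi := h (Pi.single i 1)
  have hj := h (Pi.single j 1)
  rw [qf_single, sqNorm_single] at hi hj
  have h1 := hp (Pi.single i 1 + Pi.single j 1)
  have h2 := hp (Pi.single i 1 + Pi.single j (-1))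
  rw [qf_pair hM] at h1 h2
  rw [abs_le]; constructor <;> linarith

lemma sqNorm_mulVec_le {n : ℕ} {B : Matrix (Fin n) (Fin n) ℝ} {C : ℝ}
    (h : ∀ i j, |B i j| ≤ C) (x : Fin n → ℝ) :
    sqNorm (B *ᵥ x) ≤ n * n * C ^ 2 * sqNorm x := by
  have h1 : ∀ i, (B *ᵥ x) i ^ 2 ≤ n * C ^ 2 * sqNorm x := by
    intro i
    have h2 := Finset.sum_mul_sq_le_sq_mul_sq Finset.univ (fun j => B i j) x
    have h3 : ∑ j, (B i j) ^ 2 ≤ n * C ^ 2 := by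
      calc ∑ j, (B i j) ^ 2 ≤ ∑ _j : Fin n, C ^ 2 :=
            Finset.sum_le_sum fun j _ => sq_le_sq' (abs_le.1 (h i j)).1 (abs_le.1 (h i j)).2
        _ = n * C ^ 2 := by simp
    exact h2.trans (mul_le_mul_of_nonneg_right h3 (sqNorm_nonneg x))
  calc sqNorm (B *ᵥ x) ≤ ∑ _i : Fin n, n * C ^ 2 * sqNorm x := Finset.sum_le_sum fun i _ => h1 i
    _ = _ := by simp; ring

/-! ### Transition kernels -/

section kernels

variable {n Z : ℕ} (μ : Measure Ω) [IsProbabilityMeasure μ]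
  (A : (Fin Z → ℝ) → Matrix (Fin n) (Fin n) ℝ) (ξ : ℤ → Ω → (Fin Z → ℝ))

/-- One-step transition kernel from time `k-1` to time `k`. -/
def kap (k : ℤ) : Kernel (Fin Z → ℝ) (Fin Z → ℝ) := condDistrib (ξ k) (ξ (k - 1)) μ

instance (k : ℤ) : IsMarkovKernel (kap μ ξ k) := by
  rw [kap]; infer_instance

/-- Entrywise integration against the transition kernel. -/
def opJ (k : ℤ) (F : (Fin Z → ℝ) → Matrix (Fin n) (Fin n) ℝ) :
    (Fin Z → ℝ) → Matrix (Fin n) (Fin n) ℝ :=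
  fun v => Matrix.of fun i j => ∫ w, F w i j ∂(kap μ ξ k v)

/-- Lyapunov operator. -/
def opT (k : ℤ) (F : (Fin Z → ℝ) → Matrix (Fin n) (Fin n) ℝ) :
    (Fin Z → ℝ) → Matrix (Fin n) (Fin n) ℝ :=
  fun v => (A v)ᵀ * opJ μ ξ k F v * A v

/-- Bounded measurable matrix functions. -/
def Good (F : (Fin Z → ℝ) → Matrix (Fin n) (Fin n) ℝ) : Prop :=
  (∀ i j, Measurable fun v => F v i j) ∧ ∃ C : ℝ, ∀ v i j, |F v i j| ≤ C

variable {μ A ξ}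

lemma Good.measurable {F : (Fin Z → ℝ) → Matrix (Fin n) (Fin n) ℝ} (hF : Good F) (i j : Fin n) :
    Measurable fun v => F v i j := hF.1 i j

lemma Good.integrable {F : (Fin Z → ℝ) → Matrix (Fin n) (Fin n) ℝ} (hF : Good F)
    (ν : Measure (Fin Z → ℝ)) [IsFiniteMeasure ν] (i j : Fin n) :
    Integrable (fun v => F v i j) ν := by
  obtain ⟨hm, C, hC⟩ := hF
  exact Integrable.of_bound (hm i j).aestronglyMeasurable C
    (Filter.Eventually.of_forall fun v => by simpa using hC v i j)

lemma good_one : Good (fun _ : Fin Z → ℝ => (1 : Matrix (Fin n) (Fin n) ℝ)) := by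
  refine ⟨fun i j => measurable_const, 1, fun v i j => ?_⟩
  change |(1 : Matrix (Fin n) (Fin n) ℝ) i j| ≤ 1
  rw [one_apply]; split_ifs <;> simp

lemma Good.add {F G : (Fin Z → ℝ) → Matrix (Fin n) (Fin n) ℝ} (hF : Good F) (hG : Good G) :
    Good (fun v => F v + G v) := by
  obtain ⟨hm, C, hC⟩ := hF
  obtain ⟨hm', C', hC'⟩ := hG
  exact ⟨fun i j => (hm i j).add (hm' i j), C + C', fun v i j =>
    (abs_add_le _ _).trans (add_le_add (hC v i j) (hC' v i j))⟩

lemma Good.smul {F : (Fin Z → ℝ) → Matrix (Fin n) (Fin n) ℝ} (hF : Good F) (c : ℝ) :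
    Good (fun v => c • F v) := by
  obtain ⟨hm, C, hC⟩ := hF
  refine ⟨fun i j => (hm i j).const_mul c, |c| * C, fun v i j => ?_⟩
  change |c * F v i j| ≤ |c| * C
  rw [abs_mul]
  exact mul_le_mul_of_nonneg_left (hC v i j) (abs_nonneg _)

lemma Good.mul {F G : (Fin Z → ℝ) → Matrix (Fin n) (Fin n) ℝ} (hF : Good F) (hG : Good G) :
    Good (fun v => F v * G v) := by
  obtain ⟨hm, C, hC⟩ := hF
  obtain ⟨hm', C', hC'⟩ := hG
  refine ⟨fun i j => ?_, n * (C * C'), fun v i j => ?_⟩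
  · simp only [mul_apply]
    exact Finset.measurable_sum _ fun l _ => (hm i l).mul (hm' l j)
  · change |(F v * G v) i j| ≤ _
    rw [mul_apply]
    refine (Finset.abs_sum_le_sum_abs _ _).trans ?_
    calc _ ≤ ∑ _l : Fin n, C * C' := Finset.sum_le_sum fun l _ => by
            rw [abs_mul]
            exact mul_le_mul (hC v i l) (hC' v l j) (abs_nonneg _)
              ((abs_nonneg _).trans (hC v i l))
      _ = _ := by simp

lemma Good.transpose {F : (Fin Z → ℝ) → Matrix (Fin n) (Fin n) ℝ} (hF : Good F) :
    Good (fun v => (F v)ᵀ) :=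
  ⟨fun i j => hF.1 j i, hF.2.imp fun _ h v i j => h v j i⟩

lemma Good.opJ {F : (Fin Z → ℝ) → Matrix (Fin n) (Fin n) ℝ} (hF : Good F) (k : ℤ) :
    Good (opJ μ ξ k F) := by
  obtain ⟨hm, C, hC⟩ := hF
  refine ⟨fun i j => ?_, C, fun v i j => ?_⟩
  · exact ((hm i j).stronglyMeasurable.integral_kernel).measurable
  · have := norm_integral_le_of_norm_le_const (μ := kap μ ξ k v) (f := fun w => F w i j) (C := C)
      (Filter.Eventually.of_forall fun w => by simpa using hC w i j)
    simpa [SMS.opJ] using this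

lemma Good.opT {F : (Fin Z → ℝ) → Matrix (Fin n) (Fin n) ℝ} (hA : Good A) (hF : Good F) (k : ℤ) :
    Good (opT μ A ξ k F) := (hA.transpose.mul (hF.opJ k)).mul hA

lemma qf_opJ {F : (Fin Z → ℝ) → Matrix (Fin n) (Fin n) ℝ} (hF : Good F) (k : ℤ)
    (v : Fin Z → ℝ) (x : Fin n → ℝ) :
    qf (opJ μ ξ k F v) x = ∫ w, qf (F w) x ∂(kap μ ξ k v) := by
  simp only [qf, opJ, of_apply]
  rw [integral_finsetSum]
  · refine Finset.sum_congr rfl fun i _ => ?_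
    rw [integral_finsetSum]
    · refine Finset.sum_congr rfl fun j _ => ?_
      rw [integral_const_mul]
    · exact fun j _ => (hF.integrable _ i j).const_mul _
  · exact fun i _ => integrable_finsetSum _ fun j _ => (hF.integrable _ i j).const_mul _

lemma qf_opJ_nonneg {F : (Fin Z → ℝ) → Matrix (Fin n) (Fin n) ℝ} (hF : Good F) (k : ℤ)
    (hp : ∀ v x, 0 ≤ qf (F v) x) (v : Fin Z → ℝ) (x : Fin n → ℝ) :
    0 ≤ qf (opJ μ ξ k F v) x := by
  rw [qf_opJ hF]; exact integral_nonneg fun w => hp w x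

lemma qf_opT (F : (Fin Z → ℝ) → Matrix (Fin n) (Fin n) ℝ) (k : ℤ)
    (v : Fin Z → ℝ) (x : Fin n → ℝ) :
    qf (opT μ A ξ k F v) x = qf (opJ μ ξ k F v) (A v *ᵥ x) := qf_conj _ _ _

lemma opJ_symm {F : (Fin Z → ℝ) → Matrix (Fin n) (Fin n) ℝ} (hF : ∀ v, (F v).IsSymm) (k : ℤ)
    (v : Fin Z → ℝ) : (opJ μ ξ k F v).IsSymm := by
  ext i j
  simp only [opJ, transpose_apply, of_apply]
  exact integral_congr_ae (Filter.Eventually.of_forall fun w => (hF w).apply i j)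

lemma conj_symm {M : Matrix (Fin n) (Fin n) ℝ} (hM : M.IsSymm) (B : Matrix (Fin n) (Fin n) ℝ) :
    (Bᵀ * M * B).IsSymm := by
  rw [Matrix.IsSymm, transpose_mul, transpose_mul, transpose_transpose, hM.eq, Matrix.mul_assoc]

lemma opT_symm {F : (Fin Z → ℝ) → Matrix (Fin n) (Fin n) ℝ} (hF : ∀ v, (F v).IsSymm) (k : ℤ)
    (v : Fin Z → ℝ) : (opT μ A ξ k F v).IsSymm := conj_symm (opJ_symm hF k v) _

lemma opT_add_smul {F G : (Fin Z → ℝ) → Matrix (Fin n) (Fin n) ℝ} (hF : Good F) (hG : Good G)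
    (c : ℝ) (k : ℤ) (v : Fin Z → ℝ) :
    opT μ A ξ k (fun w => F w + c • G w) v = opT μ A ξ k F v + c • opT μ A ξ k G v := by
  have : opJ μ ξ k (fun w => F w + c • G w) v = opJ μ ξ k F v + c • opJ μ ξ k G v := by
    ext i j
    simp only [opJ, of_apply, Matrix.add_apply, Matrix.smul_apply, smul_eq_mul]
    rw [integral_add (hF.integrable _ i j) ((hG.integrable _ i j).const_mul c),
      integral_const_mul]
  simp only [opT, this, Matrix.mul_add, Matrix.add_mul, Matrix.mul_smul, Matrix.smul_mul]

/-! ### Sigma-algebras -/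

lemma pastSigma_le (hξ : ∀ k : ℤ, Measurable (ξ k)) (k : ℤ) :
    pastSigma ξ k ≤ (inferInstance : MeasurableSpace Ω) :=
  iSup_le fun t => (hξ t.1).comap_le

lemma pastSigma_mono {k l : ℤ} (h : k ≤ l) : pastSigma ξ k ≤ pastSigma ξ l :=
  iSup_le fun t => le_iSup (fun t : {t : ℤ // t ≤ l} => MeasurableSpace.comap (ξ t.1) inferInstance)
    ⟨t.1, t.2.trans h⟩

lemma measurable_past {k l : ℤ} (h : k ≤ l) : Measurable[pastSigma ξ l] (ξ k) := by
  refine Measurable.of_comap_le ?_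
  exact le_iSup (fun t : {t : ℤ // t ≤ l} => MeasurableSpace.comap (ξ t.1) inferInstance) ⟨k, h⟩

lemma state_meas (hA : Good A) (k : ℤ) (x : Fin n → ℝ) (m : ℕ) (i : Fin n) :
    Measurable[pastSigma ξ (k + m - 1)] fun ω => state A ξ k x m ω i := by
  induction m generalizing i with
  | zero => exact measurable_const
  | succ m ih =>
    simp only [state, mulVec, dotProduct]
    refine Finset.measurable_sum _ fun j _ => Measurable.mul ?_ ?_
    · exact (hA.1 i j).comp (measurable_past (by push_cast; linarith))
    · exact (ih j).mono (pastSigma_mono (by push_cast; linarith)) le_rfl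

lemma state_bdd (hA : Good A) (k : ℤ) (x : Fin n → ℝ) (m : ℕ) :
    ∃ C, ∀ ω i, |state A ξ k x m ω i| ≤ C := by
  induction m with
  | zero =>
    exact ⟨∑ i, |x i|, fun ω i =>
      Finset.single_le_sum (f := fun i => |x i|) (fun i _ => abs_nonneg _) (Finset.mem_univ i)⟩
  | succ m ih =>
    obtain ⟨C, hC⟩ := ih
    obtain ⟨_, D, hD⟩ := hA
    refine ⟨n * (D * C), fun ω i => ?_⟩
    simp only [state, mulVec, dotProduct]
    refine (Finset.abs_sum_le_sum_abs _ _).trans ?_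
    calc _ ≤ ∑ _l : Fin n, D * C := Finset.sum_le_sum fun l _ => by
            rw [abs_mul]
            exact mul_le_mul (hD _ i l) (hC ω l) (abs_nonneg _)
              ((abs_nonneg _).trans (hD (ξ (k + m) ω) i l))
      _ = _ := by simp

lemma condExp_sigmaOf (hξ : ∀ k : ℤ, Measurable (ξ k)) (k : ℤ) {f : (Fin Z → ℝ) → ℝ}
    (hf : Measurable f) (hb : ∃ C, ∀ v, |f v| ≤ C) :
    μ[fun ω => f (ξ k ω) | sigmaOf (ξ (k - 1))] =ᵐ[μ]
      fun ω => ∫ w, f w ∂(kap μ ξ k (ξ (k - 1) ω)) := by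
  obtain ⟨C, hC⟩ := hb
  refine condExp_ae_eq_integral_condDistrib (hξ _) (hξ _).aemeasurable hf.stronglyMeasurable ?_
  exact Integrable.of_bound (hf.comp (hξ k)).aestronglyMeasurable C
    (Filter.Eventually.of_forall fun v => by simpa using hC _)

lemma condExpM_sigmaOf (hξ : ∀ k : ℤ, Measurable (ξ k)) (k : ℤ)
    {F : (Fin Z → ℝ) → Matrix (Fin n) (Fin n) ℝ} (hF : Good F) :
    ∀ᵐ ω ∂μ, condExpM μ (sigmaOf (ξ (k - 1))) (fun ω' => F (ξ k ω')) ω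
      = opJ μ ξ k F (ξ (k - 1) ω) := by
  have : ∀ i j, ∀ᵐ ω ∂μ, (μ[(fun ω' => F (ξ k ω') i j) | sigmaOf (ξ (k - 1))]) ω
      = ∫ w, F w i j ∂(kap μ ξ k (ξ (k - 1) ω)) := fun i j =>
    condExp_sigmaOf hξ k (hF.1 i j) (hF.2.imp fun _ h v => h v i j)
  simp only [← ae_all_iff] at this
  filter_upwards [this] with ω h
  ext i j
  exact h i j

lemma condExp_past (hξ : ∀ k : ℤ, Measurable (ξ k)) (hm : MarkovProp μ ξ) (k : ℤ)
    {f : (Fin Z → ℝ) → ℝ} (hf : Measurable f) (hb : ∃ C, ∀ v, |f v| ≤ C) :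
    μ[fun ω => f (ξ k ω) | pastSigma ξ (k - 1)] =ᵐ[μ]
      fun ω => ∫ w, f w ∂(kap μ ξ k (ξ (k - 1) ω)) :=
  (hm (k - 1) k (by linarith) f hf hb).trans (condExp_sigmaOf hξ k hf hb)

lemma integrable_term (hξ : ∀ k : ℤ, Measurable (ξ k)) (hA : Good A) {f : (Fin Z → ℝ) → ℝ}
    (hf : Measurable f) (hb : ∃ C, ∀ v, |f v| ≤ C) (k l : ℤ) (x : Fin n → ℝ) (m : ℕ)
    (i j : Fin n) :
    Integrable (fun ω => state A ξ k x m ω i * state A ξ k x m ω j * f (ξ l ω)) μ := by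
  obtain ⟨C, hC⟩ := hb
  obtain ⟨D, hD⟩ := state_bdd (ξ := ξ) hA k x m
  have hs : ∀ i, Measurable fun ω => state A ξ k x m ω i := fun i =>
    (state_meas hA k x m i).mono (pastSigma_le hξ _) le_rfl
  refine Integrable.of_bound (((hs i).mul (hs j)).mul (hf.comp (hξ l))).aestronglyMeasurable
    (D * D * C) (Filter.Eventually.of_forall fun ω => ?_)
  rw [Real.norm_eq_abs, abs_mul, abs_mul]
  have h0 : 0 ≤ D := (abs_nonneg _).trans (hD ω i)
  exact mul_le_mul (mul_le_mul (hD ω i) (hD ω j) (abs_nonneg _) h0) (hC _) (abs_nonneg _)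
    (mul_nonneg h0 h0)

lemma integrable_qf (hξ : ∀ k : ℤ, Measurable (ξ k)) (hA : Good A)
    {F : (Fin Z → ℝ) → Matrix (Fin n) (Fin n) ℝ} (hF : Good F) (k l : ℤ) (x : Fin n → ℝ) (m : ℕ) :
    Integrable (fun ω => qf (F (ξ l ω)) (state A ξ k x m ω)) μ := by
  simp only [qf]
  exact integrable_finsetSum _ fun i _ => integrable_finsetSum _ fun j _ =>
    integrable_term hξ hA (hF.1 i j) (hF.2.imp fun _ h v => h v i j) k l x m i j

/-- Conditioning one step. -/
lemma condExp_qf (hξ : ∀ k : ℤ, Measurable (ξ k)) (hm : MarkovProp μ ξ) (hA : Good A)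
    {F : (Fin Z → ℝ) → Matrix (Fin n) (Fin n) ℝ} (hF : Good F) (k : ℤ) (x : Fin n → ℝ) (m : ℕ) :
    μ[fun ω => qf (F (ξ (k + m) ω)) (state A ξ k x m ω) | pastSigma ξ (k + m - 1)] =ᵐ[μ]
      fun ω => qf (opJ μ ξ (k + m) F (ξ (k + m - 1) ω)) (state A ξ k x m ω) := by
  have hint : ∀ p : Fin n × Fin n, Integrable (fun ω => state A ξ k x m ω p.1 *
      state A ξ k x m ω p.2 * F (ξ (k + m) ω) p.1 p.2) μ := fun p =>
    integrable_term hξ hA (hF.1 p.1 p.2) (hF.2.imp fun _ h v => h v p.1 p.2) k (k + m) x m p.1 p.2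
  have hterm : ∀ p : Fin n × Fin n, μ[fun ω => state A ξ k x m ω p.1 *
      state A ξ k x m ω p.2 * F (ξ (k + m) ω) p.1 p.2 | pastSigma ξ (k + m - 1)] =ᵐ[μ]
      fun ω => state A ξ k x m ω p.1 * state A ξ k x m ω p.2 *
        opJ μ ξ (k + m) F (ξ (k + m - 1) ω) p.1 p.2 := by
    intro p
    have h1 := condExp_mul_of_stronglyMeasurable_left (μ := μ) (m := pastSigma ξ (k + m - 1))
      (f := fun ω => state A ξ k x m ω p.1 * state A ξ k x m ω p.2)
      (g := fun ω => F (ξ (k + m) ω) p.1 p.2)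
      ((state_meas hA k x m p.1).mul (state_meas hA k x m p.2)).stronglyMeasurable (hint p)
      (by
        obtain ⟨C, hC⟩ := hF.2
        exact Integrable.of_bound ((hF.1 p.1 p.2).comp (hξ _)).aestronglyMeasurable C
          (Filter.Eventually.of_forall fun v => by simpa using hC _ _ _))
    refine h1.trans ?_
    filter_upwards [condExp_past hξ hm (k + m) (hF.1 p.1 p.2)
      (hF.2.imp fun _ h v => h v p.1 p.2)] with ω hω
    simp only [Pi.mul_apply, hω]
    rfl
  have hsum := condExp_finsetSum (μ := μ) (s := Finset.univ) (fun p _ => hint p)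
    (pastSigma ξ (k + m - 1))
  have e : (fun ω => qf (F (ξ (k + m) ω)) (state A ξ k x m ω)) =
      ∑ p : Fin n × Fin n, fun ω => state A ξ k x m ω p.1 *
      state A ξ k x m ω p.2 * F (ξ (k + m) ω) p.1 p.2 := by
    ext ω
    rw [Finset.sum_apply, Fintype.sum_prod_type]
    rfl
  rw [e]
  refine hsum.trans ?_
  have hall := ae_all_iff.2 hterm
  filter_upwards [hall] with ω hω
  rw [Finset.sum_apply, Finset.sum_congr rfl fun p _ => hω p, Fintype.sum_prod_type]
  rfl

/-- The recursion for conditional quadratic moments. -/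
lemma moment_step (hξ : ∀ k : ℤ, Measurable (ξ k)) (hm : MarkovProp μ ξ) (hA : Good A)
    {F : (Fin Z → ℝ) → Matrix (Fin n) (Fin n) ℝ} (hF : Good F) (k : ℤ) (x : Fin n → ℝ) (m : ℕ) :
    μ[fun ω => qf (F (ξ (k + (m + 1)) ω)) (state A ξ k x (m + 1) ω) | pastSigma ξ (k - 1)] =ᵐ[μ]
      μ[fun ω => qf (opT μ A ξ (k + (m + 1)) F (ξ (k + m) ω)) (state A ξ k x m ω) |
        pastSigma ξ (k - 1)] := by
  have h := condExp_qf (μ := μ) hξ hm hA hF k x (m + 1)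
  have e : k + (m + 1 : ℤ) - 1 = k + m := by ring
  push_cast at h
  rw [e] at h
  have h2 := condExp_condExp_of_le (μ := μ)
    (f := fun ω => qf (F (ξ (k + (m + 1)) ω)) (state A ξ k x (m + 1) ω))
    (pastSigma_mono (ξ := ξ) (by linarith [Int.natCast_nonneg m] : k - 1 ≤ k + m))
    (pastSigma_le hξ _)
  refine h2.symm.trans ((condExp_congr_ae h).trans ?_)
  refine condExp_congr_ae (Filter.Eventually.of_forall fun ω => ?_)
  simp only [qf_opT]
  rfl

end kernels

/-! ### Periodicity -/

section periodic

variable {n Z : ℕ} {μ : Measure Ω} [IsProbabilityMeasure μ]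
  {A : (Fin Z → ℝ) → Matrix (Fin n) (Fin n) ℝ} {ξ : ℤ → Ω → (Fin Z → ℝ)} {N : ℕ}

lemma joint_periodic (hξ : ∀ k : ℤ, Measurable (ξ k)) (hper : PeriodicStationary μ ξ N) :
    Function.Periodic (fun k : ℤ => μ.map (fun ω => (ξ (k - 1) ω, ξ k ω))) (N : ℤ) := by
  intro k
  have h1 : Measurable (fun ω => fun k : ℤ => ξ (k + N) ω) :=
    measurable_pi_lambda _ fun k => hξ _
  have h2 : Measurable (fun ω => fun k : ℤ => ξ k ω) := measurable_pi_lambda _ fun k => hξ _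
  have hg : Measurable (fun p : ℤ → Fin Z → ℝ => (p (k - 1), p k)) :=
    (measurable_pi_apply _).prodMk (measurable_pi_apply _)
  have h := congrArg (Measure.map (fun p : ℤ → Fin Z → ℝ => (p (k - 1), p k))) hper
  rw [Measure.map_map hg h1, Measure.map_map hg h2] at h
  have e : k + (N : ℤ) - 1 = k - 1 + N := by ring
  simp only [e]
  exact h

lemma periodic_mod {β : Type*} {f : ℤ → β} (hf : Function.Periodic f (N : ℤ)) (k : ℤ) :
    f (k % N) = f k := by
  have := hf.sub_zsmul_eq (x := k) (k / N)
  rw [← this, Int.emod_def, smul_eq_mul, mul_comm]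

lemma kap_periodic (hξ : ∀ k : ℤ, Measurable (ξ k)) (hper : PeriodicStationary μ ξ N) :
    Function.Periodic (kap μ ξ) (N : ℤ) := by
  intro k
  have h := joint_periodic hξ hper k
  have aux : ∀ (ν₁ ν₂ : Measure ((Fin Z → ℝ) × (Fin Z → ℝ))) [IsFiniteMeasure ν₁]
      [IsFiniteMeasure ν₂], ν₁ = ν₂ → ν₁.condKernel = ν₂.condKernel := by
    intro ν₁ ν₂ _ _ e
    subst e
    rfl
  simp only [kap, condDistrib_def] at h ⊢
  exact aux _ _ h

lemma law_periodic (hξ : ∀ k : ℤ, Measurable (ξ k)) (hper : PeriodicStationary μ ξ N) :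
    Function.Periodic (fun k : ℤ => μ.map (ξ (k - 1))) (N : ℤ) := by
  intro k
  have h := congrArg (Measure.map Prod.fst) (joint_periodic hξ hper k)
  simp only at h
  rw [Measure.map_map measurable_fst ((hξ _).prodMk (hξ _)),
    Measure.map_map measurable_fst ((hξ _).prodMk (hξ _))] at h
  exact h

lemma transfer (hξ : ∀ k : ℤ, Measurable (ξ k)) (hper : PeriodicStationary μ ξ N)
    {p : (Fin Z → ℝ) → Prop} (hp : MeasurableSet {v | p v}) (j : ℤ)
    (h : ∀ᵐ ω ∂μ, p (ξ (j % N - 1) ω)) : ∀ᵐ ω ∂μ, p (ξ (j - 1) ω) := by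
  rw [← ae_map_iff (hξ _).aemeasurable hp] at h ⊢
  have : μ.map (ξ (j % N - 1)) = μ.map (ξ (j - 1)) := periodic_mod (law_periodic hξ hper) j
  rwa [← this]

lemma measurableSet_qf {H : (Fin Z → ℝ) → Matrix (Fin n) (Fin n) ℝ}
    (hH : ∀ i j, Measurable fun v => H v i j) : MeasurableSet {v | ∀ x, 0 ≤ qf (H v) x} := by
  have hm : Measurable (fun v => (fun i j => H v i j : Fin n → Fin n → ℝ)) :=
    measurable_pi_lambda _ fun i => measurable_pi_lambda _ fun j => hH i j
  have hc : IsClosed {M : Fin n → Fin n → ℝ | ∀ x : Fin n → ℝ,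
      0 ≤ ∑ i, ∑ j, x i * x j * M i j} := by
    rw [Set.ofPred_forall]
    refine isClosed_iInter fun x => isClosed_le continuous_const ?_
    fun_prop
  exact hm hc.measurableSet

lemma opJ_periodic (hξ : ∀ k : ℤ, Measurable (ξ k)) (hper : PeriodicStationary μ ξ N)
    (F : (Fin Z → ℝ) → Matrix (Fin n) (Fin n) ℝ) :
    Function.Periodic (fun k => opJ μ ξ k F) (N : ℤ) := by
  intro k
  funext v
  simp only [opJ, kap_periodic hξ hper k]

lemma opT_periodic (hξ : ∀ k : ℤ, Measurable (ξ k)) (hper : PeriodicStationary μ ξ N)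
    (F : (Fin Z → ℝ) → Matrix (Fin n) (Fin n) ℝ) :
    Function.Periodic (fun k => opT μ A ξ k F) (N : ℤ) := by
  intro k
  have := opJ_periodic hξ hper F k
  simp only at this
  funext v
  simp only [opT, this]

/-- The periodic Lyapunov condition. -/
def LyapR {n Z : ℕ} (μ : Measure Ω) (A : (Fin Z → ℝ) → Matrix (Fin n) (Fin n) ℝ)
    (ξ : ℤ → Ω → (Fin Z → ℝ)) (N : ℕ) : Prop :=
  ∃ el eu ep lam : ℝ, 0 < el ∧ 0 < eu ∧ 0 < ep ∧ 0 < lam ∧ lam < 1 ∧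
    ∃ R : ℕ → (Fin Z → ℝ) → Matrix (Fin n) (Fin n) ℝ,
      (∀ k : ℕ, ∀ i j : Fin n, Measurable fun v => R k v i j) ∧
      (∀ k : ℕ, ∀ v, (R k v).IsSymm) ∧ R N = R 0 ∧
      ∀ k : ℕ, k < N →
        (∀ᵐ ω ∂μ, (R k (ξ ((k : ℤ) - 1) ω)
            - el • (1 : Matrix (Fin n) (Fin n) ℝ)).PosSemidef) ∧
        (∀ᵐ ω ∂μ, (eu • (1 : Matrix (Fin n) (Fin n) ℝ)
            - R k (ξ ((k : ℤ) - 1) ω)).PosSemidef) ∧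
        (∀ᵐ ω ∂μ, (lam ^ 2 • R k (ξ ((k : ℤ) - 1) ω)
            - (A (ξ ((k : ℤ) - 1) ω))ᵀ
              * condExpM μ (sigmaOf (ξ ((k : ℤ) - 1)))
                  (fun ω' => R (k + 1) (ξ (k : ℤ) ω')) ω
              * A (ξ ((k : ℤ) - 1) ω)
            - ep • (1 : Matrix (Fin n) (Fin n) ℝ)).PosSemidef)

/-! ### Sufficiency -/

lemma expStable_of_family (hξ : ∀ k : ℤ, Measurable (ξ k)) (hm : MarkovProp μ ξ) (hA : Good A)
    {el eu lam : ℝ} (hel : 0 < el) (heu : 0 < eu) (hl0 : 0 < lam) (hl1 : lam < 1)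
    (R : ℤ → (Fin Z → ℝ) → Matrix (Fin n) (Fin n) ℝ) (hR : ∀ k, Good (R k))
    (h1 : ∀ k : ℤ, ∀ᵐ ω ∂μ, ∀ x, el * sqNorm x ≤ qf (R k (ξ (k - 1) ω)) x)
    (h2 : ∀ k : ℤ, ∀ᵐ ω ∂μ, ∀ x, qf (R k (ξ (k - 1) ω)) x ≤ eu * sqNorm x)
    (h3 : ∀ k : ℤ, ∀ᵐ ω ∂μ, ∀ x, qf (opT μ A ξ k (R (k + 1)) (ξ (k - 1) ω)) x
      ≤ lam ^ 2 * qf (R k (ξ (k - 1) ω)) x) : ExpStable μ A ξ := by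
  have key : ∀ (k : ℤ) (x : Fin n → ℝ) (m : ℕ), ∀ᵐ ω ∂μ,
      (μ[fun ω => qf (R (k + m + 1) (ξ (k + m) ω)) (state A ξ k x m ω) | pastSigma ξ (k - 1)]) ω
        ≤ eu * sqNorm x * lam ^ (2 * m) := by
    intro k x m
    induction m with
    | zero =>
      have h := h2 (k + 1)
      have hmono := condExp_mono (μ := μ) (m := pastSigma ξ (k - 1))
        (integrable_qf hξ hA (hR (k + ((0 : ℕ) : ℤ) + 1)) k (k + ((0 : ℕ) : ℤ)) x 0)
        (integrable_const (eu * sqNorm x)) (by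
          filter_upwards [h] with ω hω
          have := hω x
          simp only [Nat.cast_zero, add_zero, state]
          rwa [add_sub_cancel_right] at this)
      rw [condExp_const (pastSigma_le hξ _)] at hmono
      filter_upwards [hmono] with ω hω
      simpa using hω
    | succ m ih =>
      have hst := moment_step (μ := μ) hξ hm hA (hR (k + (m + 1) + 1)) k x m
      have hmono := condExp_mono (μ := μ) (m := pastSigma ξ (k - 1))
        (integrable_qf hξ hA (hA.opT (μ := μ) (ξ := ξ) (hR (k + (m + 1) + 1)) (k + (m + 1)))
          k (k + m) x m)
        ((integrable_qf hξ hA (hR (k + m + 1)) k (k + m) x m).smul (lam ^ 2)) (by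
          filter_upwards [h3 (k + m + 1)] with ω hω
          have := hω (state A ξ k x m ω)
          rw [add_sub_cancel_right, add_assoc k] at this
          simp only [Pi.smul_apply, smul_eq_mul, add_assoc k] at this ⊢
          exact this)
      have hs := condExp_smul (μ := μ) (lam ^ 2)
        (fun ω => qf (R (k + m + 1) (ξ (k + m) ω)) (state A ξ k x m ω)) (pastSigma ξ (k - 1))
      push_cast
      filter_upwards [hst, hmono, hs, ih] with ω a1 a2 a3 a4
      rw [a1]
      refine a2.trans ?_
      rw [a3, Pi.smul_apply, smul_eq_mul]
      calc _ ≤ lam ^ 2 * (eu * sqNorm x * lam ^ (2 * m)) :=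
            mul_le_mul_of_nonneg_left a4 (sq_nonneg _)
        _ = _ := by ring
  refine ⟨lam, hl0, hl1, eu / el, div_pos heu hel, fun k x m => ?_⟩
  have hi := integrable_qf (μ := μ) hξ hA (hR (k + m + 1)) k (k + m) x m
  have hmono := condExp_mono (μ := μ) (m := pastSigma ξ (k - 1))
    (integrable_qf (μ := μ) hξ hA (good_one (Z := Z) (n := n)) k (k + m) x m)
    (hi.smul el⁻¹) (by
      filter_upwards [h1 (k + m + 1)] with ω hω
      have := hω (state A ξ k x m ω)
      rw [add_sub_cancel_right] at this
      simp only [Pi.smul_apply, smul_eq_mul, qf_one]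
      rwa [le_inv_mul_iff₀ hel])
  have hs := condExp_smul (μ := μ) el⁻¹
    (fun ω => qf (R (k + m + 1) (ξ (k + m) ω)) (state A ξ k x m ω)) (pastSigma ξ (k - 1))
  simp only [qf_one] at hmono
  filter_upwards [hmono, hs, key k x m] with ω a1 a2 a3
  refine a1.trans ?_
  rw [a2, Pi.smul_apply, smul_eq_mul]
  calc _ ≤ el⁻¹ * (eu * sqNorm x * lam ^ (2 * m)) :=
        mul_le_mul_of_nonneg_left a3 (inv_nonneg.2 hel.le)
    _ = _ := by rw [div_eq_inv_mul]; ring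

/-- Entrywise clipping. -/
def clip (C : ℝ) (M : Matrix (Fin n) (Fin n) ℝ) : Matrix (Fin n) (Fin n) ℝ :=
  Matrix.of fun i j => max (-C) (min C (M i j))

lemma clip_eq {C : ℝ} {M : Matrix (Fin n) (Fin n) ℝ} (h : ∀ i j, |M i j| ≤ C) :
    clip C M = M := by
  ext i j
  have := abs_le.1 (h i j)
  simp only [clip, of_apply]
  rw [min_eq_right this.2, max_eq_right this.1]

lemma clip_good {C : ℝ} (hC : 0 ≤ C) {F : (Fin Z → ℝ) → Matrix (Fin n) (Fin n) ℝ}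
    (hF : ∀ i j, Measurable fun v => F v i j) : Good (fun v => clip C (F v)) := by
  refine ⟨fun i j => ?_, C, fun v i j => ?_⟩
  · exact measurable_const.max (measurable_const.min (hF i j))
  · change |max (-C) (min C (F v i j))| ≤ C
    rw [abs_le]
    exact ⟨le_max_left _ _, max_le (by linarith) (min_le_left _ _)⟩

lemma expStable_of_lyapR (hξ : ∀ k : ℤ, Measurable (ξ k)) (hm : MarkovProp μ ξ) (hA : Good A)
    (hN : 0 < N) (hper : PeriodicStationary μ ξ N) (h : LyapR μ A ξ N) : ExpStable μ A ξ := by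
  obtain ⟨el, eu, ep, lam, hel, heu, hep, hl0, hl1, R, hRm, hRs, hRN, hR⟩ := h
  have hNz : (0 : ℤ) < N := by exact_mod_cast hN
  have hq1 : ∀ r < N, ∀ᵐ ω ∂μ, ∀ x, el * sqNorm x ≤ qf (R r (ξ ((r : ℤ) - 1) ω)) x := by
    intro r hr
    filter_upwards [(hR r hr).1] with ω hω x
    have := psd_qf hω x
    rw [qf_sub, qf_smul, qf_one] at this
    linarith
  have hq2 : ∀ r < N, ∀ᵐ ω ∂μ, ∀ x, qf (R r (ξ ((r : ℤ) - 1) ω)) x ≤ eu * sqNorm x := by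
    intro r hr
    filter_upwards [(hR r hr).2.1] with ω hω x
    have := psd_qf hω x
    rw [qf_sub, qf_smul, qf_one] at this
    linarith
  have hent : ∀ r < N, ∀ᵐ ω ∂μ, ∀ i j, |R r (ξ ((r : ℤ) - 1) ω) i j| ≤ eu := by
    intro r hr
    filter_upwards [hq1 r hr, hq2 r hr] with ω a1 a2
    exact entry_le (hRs _ _) (fun x => (mul_nonneg hel.le (sqNorm_nonneg x)).trans (a1 x)) a2
  -- residues
  have hres : ∀ j : ℤ, (((j % N).toNat : ℕ) : ℤ) = j % N := fun j =>
    Int.toNat_of_nonneg (Int.emod_nonneg _ hNz.ne')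
  have hlt : ∀ j : ℤ, (j % N).toNat < N := fun j => by
    have := Int.emod_lt_of_pos j hNz
    have := hres j
    omega
  have hsucc : ∀ j : ℤ, R ((j + 1) % N).toNat = R ((j % N).toNat + 1) := by
    intro j
    have hr := hres j
    have hl := hlt j
    have e : (j + 1) % (N : ℤ) = (j % N + 1) % N := by simp
    by_cases hc : (j % N).toNat + 1 = N
    · have : j % (N : ℤ) + 1 = N := by omega
      rw [e, this, hc, hRN]
      simp
    · have : (j % (N : ℤ) + 1) % N = j % N + 1 := by
        apply Int.emod_eq_of_lt <;> omega
      rw [e, this]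
      congr 1
      omega
  have hentz : ∀ j : ℤ, ∀ᵐ ω ∂μ, ∀ i k, |R (j % N).toNat (ξ (j - 1) ω) i k| ≤ eu := by
    intro j
    refine transfer hξ hper (p := fun v => ∀ i k, |R (j % N).toNat v i k| ≤ eu) ?_ j ?_
    · simp only [Set.ofPred_forall]
      exact MeasurableSet.iInter fun i => MeasurableSet.iInter fun k =>
        measurableSet_le ((hRm _ i k).abs) measurable_const
    · have := hent _ (hlt j)
      rwa [hres j] at this
  -- clipped family
  set Q : ℤ → (Fin Z → ℝ) → Matrix (Fin n) (Fin n) ℝ :=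
    fun j v => clip eu (R (j % N).toNat v) with hQ
  have hQg : ∀ j, Good (Q j) := fun j => clip_good heu.le (hRm _)
  have hQeq : ∀ j : ℤ, ∀ᵐ ω ∂μ, Q j (ξ (j - 1) ω) = R (j % N).toNat (ξ (j - 1) ω) := by
    intro j
    filter_upwards [hentz j] with ω hω
    exact clip_eq hω
  have hQmod : ∀ j : ℤ, Q (j % N) = Q j := fun j => by simp [hQ]
  have hQmod1 : ∀ j : ℤ, Q (j % N + 1) = Q (j + 1) := fun j => by simp [hQ]
  have hTmod : ∀ (j : ℤ) F, opT μ A ξ (j % N) F = opT μ A ξ j F := fun j F =>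
    periodic_mod (opT_periodic hξ hper F) j
  have hQT : ∀ j : ℤ, Good (opT μ A ξ j (Q (j + 1))) := fun j => hA.opT (hQg _) j
  refine expStable_of_family hξ hm hA hel heu hl0 hl1 Q hQg ?_ ?_ ?_
  · intro j
    have := transfer hξ hper (p := fun v => ∀ x, 0 ≤ qf (Q j v + (-el) • (1 : Matrix _ _ ℝ)) x)
      (measurableSet_qf ((hQg j).add (good_one.smul (-el))).1) j (by
        have e1 := hQeq (j % N)
        have e2 := hq1 _ (hlt j)
        rw [hres j] at e2
        rw [hQmod, Int.emod_emod_of_dvd _ (dvd_refl _)] at e1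
        filter_upwards [e1, e2] with ω a1 a2 x
        rw [qf_add, qf_smul, qf_one, a1]
        linarith [a2 x])
    filter_upwards [this] with ω hω x
    have := hω x
    rw [qf_add, qf_smul, qf_one] at this
    linarith
  · intro j
    have := transfer hξ hper (p := fun v => ∀ x, 0 ≤ qf (eu • (1 : Matrix _ _ ℝ) + (-1 : ℝ) • Q j v) x)
      (measurableSet_qf ((good_one.smul eu).add ((hQg j).smul (-1))).1) j (by
        have e1 := hQeq (j % N)
        have e2 := hq2 _ (hlt j)
        rw [hres j] at e2
        rw [hQmod, Int.emod_emod_of_dvd _ (dvd_refl _)] at e1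
        filter_upwards [e1, e2] with ω a1 a2 x
        rw [qf_add, qf_smul, qf_one, qf_smul, a1]
        linarith [a2 x])
    filter_upwards [this] with ω hω x
    have := hω x
    rw [qf_add, qf_smul, qf_smul, qf_one] at this
    linarith
  · intro j
    have := transfer hξ hper
      (p := fun v => ∀ x, 0 ≤ qf (lam ^ 2 • Q j v + (-1 : ℝ) • opT μ A ξ j (Q (j + 1)) v) x)
      (measurableSet_qf (((hQg j).smul _).add ((hQT j).smul (-1))).1) j (by
        have e1 := hQeq (j % N)
        have e2 := (hR _ (hlt j)).2.2
        have e3 := hQeq (j % N + 1)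
        have e4 := condExpM_sigmaOf (μ := μ) hξ (j % N) (hQg (j + 1))
        rw [hQmod1, hsucc, Int.emod_emod_of_dvd _ (dvd_refl _), add_sub_cancel_right] at e3
        rw [hres j] at e2
        rw [hQmod, Int.emod_emod_of_dvd _ (dvd_refl _)] at e1
        have e5 : ∀ i k, ∀ᵐ ω ∂μ,
            (μ[(fun ω' => Q (j + 1) (ξ (j % N) ω') i k) | sigmaOf (ξ (j % N - 1))]) ω =
            (μ[(fun ω' => R ((j % N).toNat + 1) (ξ (j % N) ω') i k) |
              sigmaOf (ξ (j % N - 1))]) ω := fun i k => condExp_congr_ae (by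
          filter_upwards [e3] with ω a3
          rw [a3])
        simp only [← ae_all_iff] at e5
        filter_upwards [e1, e2, e4, e5] with ω a1 a2 a4 a5 x
        have a6 : condExpM μ (sigmaOf (ξ (j % N - 1)))
            (fun ω' => R ((j % N).toNat + 1) (ξ (j % N) ω')) ω
            = opJ μ ξ (j % N) (Q (j + 1)) (ξ (j % N - 1) ω) := by
          rw [← a4]
          ext i k
          exact (a5 i k).symm
        rw [a6] at a2
        have a7 := psd_qf a2 x
        rw [← hTmod, qf_add, qf_smul, qf_smul, a1]
        rw [qf_sub, qf_sub, qf_smul, qf_smul, qf_one] at a7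
        have := mul_nonneg hep.le (sqNorm_nonneg x)
        simp only [opT]
        linarith)
    filter_upwards [this] with ω hω x
    have := hω x
    rw [qf_add, qf_smul, qf_smul] at this
    linarith

/-! ### Necessity -/

/-- Iterates of the Lyapunov operator. -/
def itS (μ : Measure Ω) [IsProbabilityMeasure μ] (A : (Fin Z → ℝ) → Matrix (Fin n) (Fin n) ℝ)
    (ξ : ℤ → Ω → (Fin Z → ℝ)) : ℕ → ℤ → (Fin Z → ℝ) → Matrix (Fin n) (Fin n) ℝ
  | 0 => fun _ _ => 1
  | (m + 1) => fun k => opT μ A ξ k (itS μ A ξ m (k + 1))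

/-- Truncated Lyapunov sums. -/
def itR (μ : Measure Ω) [IsProbabilityMeasure μ] (A : (Fin Z → ℝ) → Matrix (Fin n) (Fin n) ℝ)
    (ξ : ℤ → Ω → (Fin Z → ℝ)) (lam : ℝ) :
    ℕ → ℤ → (Fin Z → ℝ) → Matrix (Fin n) (Fin n) ℝ
  | 0 => fun _ _ => 1
  | (m + 1) => fun k v => 1 + lam⁻¹ • opT μ A ξ k (itR μ A ξ lam m (k + 1)) v

lemma itS_good (hA : Good A) (m : ℕ) (k : ℤ) : Good (itS μ A ξ m k) := by
  induction m generalizing k with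
  | zero => exact good_one
  | succ m ih => exact hA.opT (ih _) k

lemma itS_symm (m : ℕ) (k : ℤ) (v) : (itS μ A ξ m k v).IsSymm := by
  induction m generalizing k v with
  | zero => exact isSymm_one
  | succ m ih => exact opT_symm (ih _) k v

lemma itS_nonneg (hA : Good A) (m : ℕ) (k : ℤ) (v x) : 0 ≤ qf (itS μ A ξ m k v) x := by
  induction m generalizing k v x with
  | zero => simp only [itS, qf_one]; exact sqNorm_nonneg x
  | succ m ih =>
    simp only [itS, qf_opT]
    exact qf_opJ_nonneg (itS_good hA m _) k (ih _) v _

lemma itR_good (hA : Good A) (lam : ℝ) (m : ℕ) (k : ℤ) : Good (itR μ A ξ lam m k) := by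
  induction m generalizing k with
  | zero => exact good_one
  | succ m ih => exact good_one.add ((hA.opT (ih _) k).smul _)

lemma itR_symm (lam : ℝ) (m : ℕ) (k : ℤ) (v) : (itR μ A ξ lam m k v).IsSymm := by
  induction m generalizing k v with
  | zero => exact isSymm_one
  | succ m ih => exact isSymm_one.add ((opT_symm (ih _) k v).smul _)

lemma itR_ge (hA : Good A) {lam : ℝ} (hl : 0 < lam) (m : ℕ) (k : ℤ) (v x) :
    sqNorm x ≤ qf (itR μ A ξ lam m k v) x := by
  induction m generalizing k v x with
  | zero => simp only [itR, qf_one]; exact le_rfl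
  | succ m ih =>
    simp only [itR, qf_add, qf_smul, qf_opT, qf_one]
    have := qf_opJ_nonneg (μ := μ) (ξ := ξ) (itR_good hA lam m (k + 1)) k
      (fun v x => (sqNorm_nonneg x).trans (ih (k + 1) v x)) v (A v *ᵥ x)
    have := mul_nonneg (inv_nonneg.2 hl.le) this
    linarith

lemma itR_succ (hA : Good A) (lam : ℝ) (m : ℕ) (k : ℤ) (v) :
    itR μ A ξ lam (m + 1) k v
      = itR μ A ξ lam m k v + (lam⁻¹) ^ (m + 1) • itS μ A ξ (m + 1) k v := by
  induction m generalizing k v with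
  | zero => simp [itR, itS]
  | succ m ih =>
    have e : itR μ A ξ lam (m + 1) (k + 1) = fun w => itR μ A ξ lam m (k + 1) w
        + (lam⁻¹) ^ (m + 1) • itS μ A ξ (m + 1) (k + 1) w := funext fun w => ih (k + 1) w
    change 1 + lam⁻¹ • opT μ A ξ k (itR μ A ξ lam (m + 1) (k + 1)) v = _
    rw [e, opT_add_smul (itR_good hA _ _ _) (itS_good hA _ _)]
    rw [show itR μ A ξ lam (m + 1) k v
      = 1 + lam⁻¹ • opT μ A ξ k (itR μ A ξ lam m (k + 1)) v from rfl]
    rw [show itS μ A ξ (m + 1 + 1) k v = opT μ A ξ k (itS μ A ξ (m + 1) (k + 1)) v from rfl]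
    rw [smul_add, smul_smul, ← pow_succ', ← add_assoc (1 : Matrix (Fin n) (Fin n) ℝ)]

lemma itR_periodic (hξ : ∀ k : ℤ, Measurable (ξ k)) (hper : PeriodicStationary μ ξ N)
    (lam : ℝ) (m : ℕ) : Function.Periodic (itR μ A ξ lam m) (N : ℤ) := by
  induction m with
  | zero => intro k; rfl
  | succ m ih =>
    intro k
    have h1 := ih (k + 1)
    have h2 := opT_periodic (A := A) hξ hper (itR μ A ξ lam m (k + 1)) k
    simp only at h2
    simp only [itR]
    rw [show k + (N : ℤ) + 1 = k + 1 + N by ring, h1, h2]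

lemma moment_itS (hξ : ∀ k : ℤ, Measurable (ξ k)) (hm : MarkovProp μ ξ) (hA : Good A)
    (k : ℤ) (x : Fin n → ℝ) (m p : ℕ) :
    μ[fun ω => qf (itS μ A ξ p (k + m + 1) (ξ (k + m) ω)) (state A ξ k x m ω) |
        pastSigma ξ (k - 1)] =ᵐ[μ]
      fun ω => qf (opJ μ ξ k (itS μ A ξ (p + m) (k + 1)) (ξ (k - 1) ω)) x := by
  induction m generalizing p with
  | zero =>
    have := condExp_qf (μ := μ) hξ hm hA (itS_good (μ := μ) (ξ := ξ) hA p (k + 1)) k x 0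
    simpa [state] using this
  | succ m ih =>
    have h1 := moment_step (μ := μ) hξ hm hA
      (itS_good (μ := μ) (ξ := ξ) hA p (k + (m + 1) + 1)) k x m
    have h2 := ih (p + 1)
    push_cast
    refine h1.trans ?_
    rw [show p + (m + 1) = p + 1 + m by ring]
    rw [← add_assoc k]
    exact h2

lemma lyapR_of_expStable (hξ : ∀ k : ℤ, Measurable (ξ k)) (hm : MarkovProp μ ξ) (hA : Good A)
    (hper : PeriodicStationary μ ξ N) (h : ExpStable μ A ξ) : LyapR μ A ξ N := by
  obtain ⟨lam, hl0, hl1, a, ha, hst⟩ := h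
  obtain ⟨M, hM⟩ := hA.2
  -- decay of the iterates
  set C : ℝ := n * a * (n * n * M ^ 2) with hC
  have hC0 : 0 ≤ C := by positivity
  have hS : ∀ (m : ℕ) (k : ℤ), ∀ᵐ ω ∂μ, ∀ x,
      qf (itS μ A ξ (m + 1) k (ξ (k - 1) ω)) x ≤ C * lam ^ (2 * m) * sqNorm x := by
    intro m k
    have hd : ∀ i, ∀ᵐ ω ∂μ, opJ μ ξ k (itS μ A ξ m (k + 1)) (ξ (k - 1) ω) i i
        ≤ a * lam ^ (2 * m) := by
      intro i
      have h1 := moment_itS (μ := μ) hξ hm hA k (Pi.single i 1) m 0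
      simp only [itS, qf_one, zero_add] at h1
      filter_upwards [h1, hst k (Pi.single i 1) m] with ω a1 a2
      rw [smom, a1, qf_single, sqNorm_single] at a2
      linarith
    filter_upwards [ae_all_iff.2 hd] with ω hω x
    have h2 := qf_le_of_diag (opJ_symm (itS_symm m (k + 1)) k _)
      (qf_opJ_nonneg (itS_good hA m (k + 1)) k (itS_nonneg hA m (k + 1)) _) hω
      (A (ξ (k - 1) ω) *ᵥ x)
    have h3 := sqNorm_mulVec_le (hM (ξ (k - 1) ω)) x
    simp only [itS, qf_opT]
    refine h2.trans ?_
    calc _ ≤ n * (a * lam ^ (2 * m)) * (n * n * M ^ 2 * sqNorm x) :=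
          mul_le_mul_of_nonneg_left h3 (by positivity)
      _ = _ := by rw [hC]; ring
  obtain ⟨L, hL⟩ : ∃ L : ℕ, C * lam ^ L ≤ lam / 2 := by
    have ht := (tendsto_pow_atTop_nhds_zero_of_lt_one hl0.le hl1).const_mul C
    rw [mul_zero] at ht
    exact ((ht.eventually (gt_mem_nhds (half_pos hl0))).exists).imp fun _ h => h.le
  -- bound
  have hbd : ∃ D : ℝ, 0 < D ∧ ∀ k < N, ∀ v i j, |itR μ A ξ lam L (k : ℕ) v i j| ≤ D := by
    choose D hD using fun k : ℕ => (itR_good (μ := μ) (ξ := ξ) hA lam L k).2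
    refine ⟨1 + ∑ k ∈ Finset.range N, |D k|, by positivity, fun k hk v i j => ?_⟩
    have := Finset.single_le_sum (f := fun k => |D k|) (fun i _ => abs_nonneg _)
      (Finset.mem_range.2 hk)
    have := hD k v i j
    have := le_abs_self (D k)
    linarith
  obtain ⟨D, hD0, hD⟩ := hbd
  refine ⟨1, n * D + 1, lam / 2, √lam, one_pos, by positivity, half_pos hl0, Real.sqrt_pos.2 hl0,
    by rw [Real.sqrt_lt' one_pos]; simpa using hl1, fun k => itR μ A ξ lam L (k : ℤ),
    fun k => (itR_good hA lam L k).1, fun k v => itR_symm lam L k v, ?_, fun k hk => ⟨?_, ?_, ?_⟩⟩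
  · simpa using itR_periodic (A := A) hξ hper lam L 0
  · refine Filter.Eventually.of_forall fun ω => ?_
    rw [psd_iff ((itR_symm _ _ _ _).sub (isSymm_one.smul _))]
    intro x
    rw [qf_sub, qf_smul, qf_one, one_mul, sub_nonneg]
    exact itR_ge hA hl0 L k _ x
  · refine Filter.Eventually.of_forall fun ω => ?_
    rw [psd_iff ((isSymm_one.smul _).sub (itR_symm _ _ _ _))]
    intro x
    rw [qf_sub, qf_smul, qf_one, sub_nonneg]
    have := qf_le_of_entries (hD k hk (ξ ((k : ℤ) - 1) ω)) x
    have := sqNorm_nonneg x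
    linarith
  · filter_upwards [hS L k, condExpM_sigmaOf (μ := μ) hξ k
      (itR_good (μ := μ) (ξ := ξ) hA lam L (k + 1))] with ω a1 a2
    push_cast
    rw [a2]
    have hTs : ((A (ξ ((k : ℤ) - 1) ω))ᵀ * opJ μ ξ k (itR μ A ξ lam L (k + 1)) (ξ ((k : ℤ) - 1) ω)
        * A (ξ ((k : ℤ) - 1) ω)).IsSymm := opT_symm (itR_symm lam L (k + 1)) k _
    rw [psd_iff ((((itR_symm _ _ _ _).smul _).sub hTs).sub (isSymm_one.smul _))]
    intro x
    have e1 := itR_succ (μ := μ) (ξ := ξ) hA lam L k (ξ ((k : ℤ) - 1) ω)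
    have e2 := congrArg (fun M => qf M x) e1
    simp only [itR, qf_add, qf_smul, qf_one] at e2
    rw [qf_sub, qf_sub, qf_smul, qf_smul, qf_one, Real.sq_sqrt hl0.le]
    change 0 ≤ _ - qf (opT μ A ξ k (itR μ A ξ lam L (k + 1)) (ξ ((k : ℤ) - 1) ω)) x - _
    have a3 := a1 x
    set t := qf (opT μ A ξ k (itR μ A ξ lam L (k + 1)) (ξ ((k : ℤ) - 1) ω)) x
    set r := qf (itR μ A ξ lam L k (ξ ((k : ℤ) - 1) ω)) x
    set s := qf (itS μ A ξ (L + 1) k (ξ ((k : ℤ) - 1) ω)) x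
    have hx := sqNorm_nonneg x
    have e3 : lam * sqNorm x + t = lam * r + (lam⁻¹) ^ L * s := by
      have := congrArg (fun z => lam * z) e2
      simp only [mul_add, pow_succ] at this
      field_simp at this ⊢
      linarith
    have e4 : (lam⁻¹) ^ L * s ≤ lam / 2 * sqNorm x := by
      calc (lam⁻¹) ^ L * s ≤ (lam⁻¹) ^ L * (C * lam ^ (2 * L) * sqNorm x) :=
            mul_le_mul_of_nonneg_left a3 (by positivity)
        _ = C * lam ^ L * sqNorm x := by
            rw [inv_pow, two_mul, pow_add]; field_simp
        _ ≤ _ := mul_le_mul_of_nonneg_right hL hx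
    linarith

/-! ### Reduction to bounded coefficients -/

lemma state_congr {A B : (Fin Z → ℝ) → Matrix (Fin n) (Fin n) ℝ} {ω : Ω}
    (h : ∀ k, A (ξ k ω) = B (ξ k ω)) (k : ℤ) (x : Fin n → ℝ) (m : ℕ) :
    state A ξ k x m ω = state B ξ k x m ω := by
  induction m with
  | zero => rfl
  | succ m ih => simp only [state, h, ih]

lemma expStable_congr {A B : (Fin Z → ℝ) → Matrix (Fin n) (Fin n) ℝ}
    (h : ∀ᵐ ω ∂μ, ∀ k, A (ξ k ω) = B (ξ k ω)) (hs : ExpStable μ A ξ) : ExpStable μ B ξ := by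
  obtain ⟨lam, h0, h1, a, ha, hst⟩ := hs
  refine ⟨lam, h0, h1, a, ha, fun k x m => ?_⟩
  have hc : smom μ A ξ k x m =ᵐ[μ] smom μ B ξ k x m := condExp_congr_ae (by
    filter_upwards [h] with ω hω
    rw [state_congr hω])
  filter_upwards [hc, hst k x m] with ω a1 a2
  rwa [← a1]

lemma lyapR_congr {A B : (Fin Z → ℝ) → Matrix (Fin n) (Fin n) ℝ}
    (h : ∀ᵐ ω ∂μ, ∀ k, A (ξ k ω) = B (ξ k ω)) (hs : LyapR μ A ξ N) : LyapR μ B ξ N := by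
  obtain ⟨el, eu, ep, lam, hel, heu, hep, hl0, hl1, R, hRm, hRs, hRN, hR⟩ := hs
  refine ⟨el, eu, ep, lam, hel, heu, hep, hl0, hl1, R, hRm, hRs, hRN, fun k hk =>
    ⟨(hR k hk).1, (hR k hk).2.1, ?_⟩⟩
  filter_upwards [(hR k hk).2.2, h] with ω a1 a2
  rwa [← a2]

lemma main_iff (hA : ∀ i j : Fin n, Measurable fun v => A v i j)
    (hξ : ∀ k : ℤ, Measurable (ξ k)) (hN : 0 < N)
    (h3 : Assumption3 μ A ξ) (hm : MarkovProp μ ξ) (hper : PeriodicStationary μ ξ N) :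
    ExpStable μ A ξ ↔ LyapR μ A ξ N := by
  obtain ⟨M, hM0, hM⟩ := h3
  have hB : Good (fun v => clip M (A v)) := clip_good hM0.le hA
  have hAB : ∀ᵐ ω ∂μ, ∀ k, A (ξ k ω) = clip M (A (ξ k ω)) := by
    simp only [← ae_all_iff] at hM
    filter_upwards [hM] with ω hω k
    exact (clip_eq fun i j => (hω k i j).le).symm
  have hBA : ∀ᵐ ω ∂μ, ∀ k, clip M (A (ξ k ω)) = A (ξ k ω) := by
    filter_upwards [hAB] with ω hω k
    exact (hω k).symm
  constructor
  · intro h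
    exact lyapR_congr (A := fun v => clip M (A v)) hBA
      (lyapR_of_expStable hξ hm hB hper (expStable_congr hAB h))
  · intro h
    exact expStable_congr (A := fun v => clip M (A v)) hBA
      (expStable_of_lyapR hξ hm hB hN hper (lyapR_congr hAB h))

end periodic

theorem periodic_markov_expStable_iff_periodic_lyapR {n Z : ℕ} (hn : 0 < n) (hZ : 0 < Z) {Ω : Type} [MeasurableSpace Ω]
    (μ : Measure Ω) [IsProbabilityMeasure μ]
    (A : (Fin Z → ℝ) → Matrix (Fin n) (Fin n) ℝ)
    (hA : ∀ i j : Fin n, Measurable fun v => A v i j)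
    (ξ : ℤ → Ω → (Fin Z → ℝ)) (hξ : ∀ k : ℤ, Measurable (ξ k))
    (N : ℕ) (hN : 0 < N)
    (h3 : Assumption3 μ A ξ) (hm : MarkovProp μ ξ) (hper : PeriodicStationary μ ξ N) :
    ExpStable μ A ξ ↔
      ∃ el eu ep lam : ℝ, 0 < el ∧ 0 < eu ∧ 0 < ep ∧ 0 < lam ∧ lam < 1 ∧
        ∃ R : ℕ → (Fin Z → ℝ) → Matrix (Fin n) (Fin n) ℝ,
          (∀ k : ℕ, ∀ i j : Fin n, Measurable fun v => R k v i j) ∧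
          (∀ k : ℕ, ∀ v, (R k v).IsSymm) ∧ R N = R 0 ∧
          ∀ k : ℕ, k < N →
            (∀ᵐ ω ∂μ, (R k (ξ ((k : ℤ) - 1) ω)
                - el • (1 : Matrix (Fin n) (Fin n) ℝ)).PosSemidef) ∧
            (∀ᵐ ω ∂μ, (eu • (1 : Matrix (Fin n) (Fin n) ℝ)
                - R k (ξ ((k : ℤ) - 1) ω)).PosSemidef) ∧
            (∀ᵐ ω ∂μ, (lam ^ 2 • R k (ξ ((k : ℤ) - 1) ω)
                - (A (ξ ((k : ℤ) - 1) ω))ᵀ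
                  * condExpM μ (sigmaOf (ξ ((k : ℤ) - 1)))
                      (fun ω' => R (k + 1) (ξ (k : ℤ) ω')) ω
                  * A (ξ ((k : ℤ) - 1) ω)
                - ep • (1 : Matrix (Fin n) (Fin n) ℝ)).PosSemidef) := by
  exact main_iff hA hξ hN h3 hm hper

end SMS

end
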